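/- For every finite simple graph G and every positive integer q, the join of G with the complete graph K_q satisfies A_b(G ∨ K_q) = A_b(G) + q. -/

import Mathlib

open SimpleGraph

namespace AcyclicB

variable {V : Type*}

/-- `c` is a proper vertex coloring of `G`. -/
def Proper (G : SimpleGraph V) (c : V → ℕ) : Prop :=
  ∀ ⦃u v : V⦄, G.Adj u v → c u ≠ c v

/-- `c` is an acyclic (proper) coloring of `G`: the subgraph induced by the union of
any two color classes is a forest. -/
def IsAcyclicColoring (G : SimpleGraph V) (c : V → ℕ) : Prop :=
  Proper G c ∧ ∀ i j : ℕ, (G.induce {v | c v = i ∨ c v = j}).IsAcyclic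

/-- The closed neighborhood of `v` in `G`. -/
def closedNbhd (G : SimpleGraph V) (v : V) : Set V :=
  insert v (G.neighborSet v)

/-- `c'` is obtained from the acyclic coloring `c` by an acyclic recoloring step removing
one color `i`: every vertex of a color different from `i` keeps its color, and every vertex
of color `i` receives a color (among the colors of `c`, different from `i`) that is absent
from its closed neighborhood; the resulting coloring is again acyclic. -/
def RecolorStep (G : SimpleGraph V) (c' c : V → ℕ) : Prop :=
  IsAcyclicColoring G c ∧ IsAcyclicColoring G c' ∧
  ∃ i ∈ Set.range c,
    (∀ v, c v ≠ i → c' v = c v) ∧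
    (∀ v, c v = i → c' v ∈ Set.range c ∧ c' v ≠ i ∧
      ∀ u ∈ closedNbhd G v, c u ≠ c' v)

/-- The strict partial order `≺ₐ` on acyclic colorings: the transitive closure of the
acyclic recoloring step relation. -/
def StrictOrder (G : SimpleGraph V) : (V → ℕ) → (V → ℕ) → Prop :=
  Relation.TransGen (RecolorStep G)

/-- `c` is a minimal element of `≺ₐ`: an acyclic coloring admitting no acyclic recoloring
step. -/
def IsMinimal (G : SimpleGraph V) (c : V → ℕ) : Prop :=
  IsAcyclicColoring G c ∧ ∀ c', ¬ RecolorStep G c' c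

/-- The number of colors used by `c`. -/
def ncolors [Fintype V] (c : V → ℕ) : ℕ :=
  (Finset.univ.image c).card

/-- The acyclic b-chromatic number of `G`: the maximum number of colors used by a minimal
element of `≺ₐ`. -/
noncomputable def Ab [Fintype V] (G : SimpleGraph V) : ℕ :=
  sSup { k | ∃ c : V → ℕ, IsMinimal G c ∧ ncolors c = k }

/-- The acyclic chromatic number of `G`: the minimum number of colors in an acyclic
proper coloring. -/
noncomputable def Achrom [Fintype V] (G : SimpleGraph V) : ℕ :=
  sInf { k | ∃ c : V → ℕ, IsAcyclicColoring G c ∧ ncolors c = k }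

/-- The join of two graphs: disjoint copies of `G` and `H` together with all edges
between them. -/
def join {α β : Type*} (G : SimpleGraph α) (H : SimpleGraph β) : SimpleGraph (α ⊕ β) where
  Adj x y :=
    match x, y with
    | Sum.inl a, Sum.inl a' => G.Adj a a'
    | Sum.inr b, Sum.inr b' => H.Adj b b'
    | Sum.inl _, Sum.inr _ => True
    | Sum.inr _, Sum.inl _ => True
  symm := by
    constructor
    rintro (a | b) (a' | b') h
    · exact G.symm.symm _ _ h
    · trivial
    · trivial
    · exact H.symm.symm _ _ h
  loopless := by
    constructor
    rintro (a | b) h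
    · exact G.loopless.irrefl a h
    · exact H.loopless.irrefl b h

end AcyclicB

namespace AcyclicB

/-- A graph all of whose edges meet a fixed vertex is acyclic. -/
lemma isAcyclic_of_forall_adj_eq {H : SimpleGraph V} (w : V)
    (h : ∀ u v, H.Adj u v → u = w ∨ v = w) : H.IsAcyclic := by
  have key : ∀ x, H.Adj x w → ¬ (H.deleteEdges {s(x, w)}).Reachable x w := by
    rintro x hx ⟨p⟩
    cases p with
    | nil => exact hx.ne rfl
    | cons hy _ =>
      rw [deleteEdges_adj] at hy
      obtain ⟨hxy, hne⟩ := hy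
      rcases h _ _ hxy with rfl | rfl
      · exact hx.ne rfl
      · exact hne rfl
  rw [isAcyclic_iff_forall_adj_isBridge]
  intro u v huv
  rw [isBridge_iff]
  rcases h u v huv with rfl | rfl
  · intro hr
    rw [Sym2.eq_swap] at hr
    exact key v huv.symm hr.symm
  · exact key u huv

lemma isAcyclicColoring_join_completeGraph_iff {α β : Type*} {G : SimpleGraph α}
    {c : α ⊕ β → ℕ} :
    IsAcyclicColoring (join G (completeGraph β)) c ↔
      IsAcyclicColoring G (c ∘ Sum.inl) ∧ Function.Injective (c ∘ Sum.inr) ∧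
        ∀ a b, c (Sum.inl a) ≠ c (Sum.inr b) := by
  constructor
  · rintro ⟨hp, hac⟩
    refine ⟨⟨fun u v huv => hp (u := Sum.inl u) (v := Sum.inl v) huv, fun i j => ?_⟩, ?_,
      fun a b => hp (u := Sum.inl a) (v := Sum.inr b) trivial⟩
    · let f : G.induce {v | (c ∘ Sum.inl) v = i ∨ (c ∘ Sum.inl) v = j} →g
          (join G (completeGraph β)).induce {v | c v = i ∨ c v = j} :=
        { toFun := fun x => ⟨Sum.inl x.1, x.2⟩
          map_rel' := fun h => h }
      refine (hac i j).comap f fun x y hxy => Subtype.ext ?_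
      exact Sum.inl_injective (congrArg Subtype.val hxy)
    · intro a b hab
      by_contra hne
      exact hp (u := Sum.inr a) (v := Sum.inr b) hne hab
  · rintro ⟨⟨hp, hac⟩, hinj, hdisj⟩
    have hproper : Proper (join G (completeGraph β)) c := by
      rintro (a | b) (a' | b') h
      · exact hp h
      · exact hdisj a b'
      · exact (hdisj a' b).symm
      · exact fun he => h (hinj he)
    refine ⟨hproper, fun i j => ?_⟩
    by_cases hb : ∃ b, c (Sum.inr b) = i ∨ c (Sum.inr b) = j
    · obtain ⟨b, hb⟩ := hb
      have huniq : ∀ x, c x = c (Sum.inr b) → x = Sum.inr b := by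
        rintro (a | b') hx
        · exact absurd hx (hdisj a b)
        · exact congrArg Sum.inr (hinj hx)
      refine isAcyclic_of_forall_adj_eq ⟨Sum.inr b, hb⟩ ?_
      rintro ⟨u, hu⟩ ⟨v, hv⟩ huv
      have hne : c u ≠ c v := hproper huv
      have : c u = c (Sum.inr b) ∨ c v = c (Sum.inr b) := by
        simp only [Set.mem_ofPred_eq] at hu hv
        omega
      exact this.imp (fun h => Subtype.ext (huniq _ h)) (fun h => Subtype.ext (huniq _ h))
    · push Not at hb
      have hleft : ∀ x : {v | c v = i ∨ c v = j}, ∃ a, Sum.inl a = x.1 := by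
        rintro ⟨a | b, hx⟩
        · exact ⟨a, rfl⟩
        · exact (hx.elim (hb b).1 (hb b).2).elim
      choose g hg using hleft
      let f : (join G (completeGraph β)).induce {v | c v = i ∨ c v = j} →g
          G.induce {v | (c ∘ Sum.inl) v = i ∨ (c ∘ Sum.inl) v = j} :=
        { toFun := fun x => ⟨g x, by
            have := x.2
            rw [← hg x] at this
            exact this⟩
          map_rel' := fun {x y} h => by
            have h' : (join G (completeGraph β)).Adj x.1 y.1 := h
            rw [← hg x, ← hg y] at h'
            exact h' }
      refine (hac i j).comap f fun x y hxy => Subtype.ext ?_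
      rw [← hg x, ← hg y]
      exact congrArg Sum.inl (congrArg Subtype.val hxy)

lemma RecolorStep.comp_inl {α β : Type*} {G : SimpleGraph α} {c c' : α ⊕ β → ℕ}
    (h : RecolorStep (join G (completeGraph β)) c' c) :
    RecolorStep G (c' ∘ Sum.inl) (c ∘ Sum.inl) := by
  obtain ⟨hc, hc', i, ⟨x, rfl⟩, hfix, hmove⟩ := h
  refine ⟨(isAcyclicColoring_join_completeGraph_iff.1 hc).1,
    (isAcyclicColoring_join_completeGraph_iff.1 hc').1, c x, ?_, fun v => hfix _, ?_⟩
  · rcases x with a | b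
    · exact ⟨a, rfl⟩
    · obtain ⟨⟨y, hy⟩, -, hnb⟩ := hmove (Sum.inr b) rfl
      refine (hnb y ?_ hy).elim
      rcases y with a | b'
      · exact Or.inr trivial
      · by_cases hbb : b = b'
        · exact Or.inl (congrArg Sum.inr hbb.symm)
        · exact Or.inr hbb
  · intro v hv
    obtain ⟨⟨y, hy⟩, hne, hnb⟩ := hmove (Sum.inl v) hv
    refine ⟨?_, hne, fun u hu => hnb (Sum.inl u) ?_⟩
    · rcases y with a | b
      · exact ⟨a, hy⟩
      · exact (hnb (Sum.inr b) (Or.inr trivial) hy).elim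
    · exact hu.imp (congrArg Sum.inl) id

lemma RecolorStep.range_subset {G : SimpleGraph V} {c c' : V → ℕ} (h : RecolorStep G c' c) :
    Set.range c' ⊆ Set.range c := by
  obtain ⟨-, -, i, -, hfix, hmove⟩ := h
  rintro _ ⟨v, rfl⟩
  by_cases hv : c v = i
  · exact (hmove v hv).1
  · exact ⟨v, (hfix v hv).symm⟩

lemma RecolorStep.sumElim {α β : Type*} {G : SimpleGraph α} {c : α ⊕ β → ℕ} {d : α → ℕ}
    (hc : IsAcyclicColoring (join G (completeGraph β)) c)
    (h : RecolorStep G d (c ∘ Sum.inl)) :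
    RecolorStep (join G (completeGraph β)) (Sum.elim d (c ∘ Sum.inr)) c := by
  have hr := h.range_subset
  obtain ⟨-, hd, i, ⟨x, rfl⟩, hfix, hmove⟩ := h
  obtain ⟨-, hinj, hdisj⟩ := isAcyclicColoring_join_completeGraph_iff.1 hc
  refine ⟨hc, isAcyclicColoring_join_completeGraph_iff.2 ⟨hd, hinj, fun a b hab => ?_⟩,
    c (Sum.inl x), ⟨_, rfl⟩, ?_, ?_⟩
  · obtain ⟨y, hy⟩ := hr ⟨a, rfl⟩
    exact hdisj y b (hy.trans hab)
  · rintro (a | b) hv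
    · exact hfix a hv
    · rfl
  · rintro (a | b) hv
    · obtain ⟨⟨y, hy⟩, hne, hnb⟩ := hmove a hv
      refine ⟨⟨Sum.inl y, hy⟩, hne, ?_⟩
      rintro (u | b) hu
      · exact hnb u (hu.imp (fun h => Sum.inl_injective h) id)
      · exact fun he => hdisj y b (hy.trans he.symm)
    · exact absurd hv.symm (hdisj x b)

lemma isMinimal_join_completeGraph_iff {α β : Type*} {G : SimpleGraph α} {c : α ⊕ β → ℕ} :
    IsMinimal (join G (completeGraph β)) c ↔
      IsMinimal G (c ∘ Sum.inl) ∧ Function.Injective (c ∘ Sum.inr) ∧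
        ∀ a b, c (Sum.inl a) ≠ c (Sum.inr b) := by
  constructor
  · rintro ⟨hc, hmin⟩
    have h := isAcyclicColoring_join_completeGraph_iff.1 hc
    exact ⟨⟨h.1, fun d hd => hmin _ (hd.sumElim hc)⟩, h.2⟩
  · rintro ⟨⟨hc, hmin⟩, h⟩
    exact ⟨isAcyclicColoring_join_completeGraph_iff.2 ⟨hc, h⟩, fun d hd => hmin _ hd.comp_inl⟩

lemma ncolors_sum {α β : Type*} [Fintype α] [Fintype β] {c : α ⊕ β → ℕ}
    (hinj : Function.Injective (c ∘ Sum.inr)) (hdisj : ∀ a b, c (Sum.inl a) ≠ c (Sum.inr b)) :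
    ncolors c = ncolors (c ∘ Sum.inl) + Fintype.card β := by
  have hu : Finset.univ.image c =
      Finset.univ.image (c ∘ Sum.inl) ∪ Finset.univ.image (c ∘ Sum.inr) := by
    ext k
    simp
  have hd : Disjoint (Finset.univ.image (c ∘ Sum.inl)) (Finset.univ.image (c ∘ Sum.inr)) := by
    rw [Finset.disjoint_left]
    intro k hk hk'
    obtain ⟨a, -, rfl⟩ := Finset.mem_image.1 hk
    obtain ⟨b, -, hb⟩ := Finset.mem_image.1 hk'
    exact hdisj a b hb.symm
  rw [ncolors, hu, Finset.card_union_of_disjoint hd, Finset.card_image_of_injective _ hinj,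
    Finset.card_univ, ncolors]

lemma RecolorStep.ncolors_lt [Fintype V] {G : SimpleGraph V} {c c' : V → ℕ}
    (h : RecolorStep G c' c) : ncolors c' < ncolors c := by
  have hr := h.range_subset
  obtain ⟨-, -, i, ⟨x, rfl⟩, hfix, hmove⟩ := h
  refine Finset.card_lt_card (Finset.ssubset_iff_of_subset ?_ |>.2 ⟨c x, by simp, ?_⟩)
  · intro k hk
    simpa using hr (by simpa using hk)
  · intro hk
    obtain ⟨v, -, hv⟩ := Finset.mem_image.1 hk
    by_cases hvx : c v = c x
    · exact (hmove v hvx).2.1 hv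
    · exact hvx ((hfix v hvx).symm.trans hv)

lemma isAcyclicColoring_of_injective {G : SimpleGraph V} {c : V → ℕ}
    (hc : Function.Injective c) : IsAcyclicColoring G c := by
  refine ⟨fun u v huv he => huv.ne (hc he), fun i j => ?_⟩
  by_cases hi : ∃ w, c w = i
  · obtain ⟨w, rfl⟩ := hi
    refine isAcyclic_of_forall_adj_eq ⟨w, Or.inl rfl⟩ ?_
    rintro ⟨u, hu⟩ ⟨v, hv⟩ huv
    rcases hu with hu | hu
    · exact Or.inl (Subtype.ext (hc hu))
    · rcases hv with hv | hv
      · exact Or.inr (Subtype.ext (hc hv))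
      · exact (huv.ne (Subtype.ext (hc (hu.trans hv.symm)))).elim
  · push Not at hi
    rintro ⟨v, hv⟩ p hp
    cases p with
    | nil => exact (hp.ne_nil rfl).elim
    | @cons _ w _ hw _ =>
      refine (hw.ne (Subtype.ext (hc ?_))).elim
      exact (hv.resolve_left (hi v)).trans (w.2.resolve_left (hi w)).symm

lemma exists_isMinimal [Fintype V] (G : SimpleGraph V) : ∃ c, IsMinimal G c := by
  have hne : {c : V → ℕ | IsAcyclicColoring G c}.Nonempty :=
    ⟨fun v => Fintype.equivFin V v,
      isAcyclicColoring_of_injective (Fin.val_injective.comp (Fintype.equivFin V).injective)⟩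
  obtain ⟨c, hc, hmin⟩ := WellFounded.has_min (measure (ncolors (V := V))).wf _ hne
  exact ⟨c, hc, fun d hd => hmin d hd.2.1 hd.ncolors_lt⟩

lemma ncolors_le_card [Fintype V] (c : V → ℕ) : ncolors c ≤ Fintype.card V :=
  Finset.card_image_le

lemma bddAbove_ncolors_isMinimal [Fintype V] (G : SimpleGraph V) :
    BddAbove {k | ∃ c : V → ℕ, IsMinimal G c ∧ ncolors c = k} := by
  refine ⟨Fintype.card V, ?_⟩
  rintro _ ⟨c, -, rfl⟩
  exact ncolors_le_card c

lemma IsMinimal.ncolors_le_Ab [Fintype V] {G : SimpleGraph V} {c : V → ℕ}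
    (hc : IsMinimal G c) : ncolors c ≤ Ab G :=
  le_csSup (bddAbove_ncolors_isMinimal G) ⟨c, hc, rfl⟩

lemma exists_isMinimal_ncolors_eq_Ab [Fintype V] (G : SimpleGraph V) :
    ∃ c : V → ℕ, IsMinimal G c ∧ ncolors c = Ab G := by
  obtain ⟨c, hc⟩ := exists_isMinimal G
  have hne : {k | ∃ c : V → ℕ, IsMinimal G c ∧ ncolors c = k}.Nonempty :=
    ⟨_, c, hc, rfl⟩
  exact Nat.sSup_mem hne (bddAbove_ncolors_isMinimal G)

/-- For every finite simple graph `G` and every positive integer `q`,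
`A_b(G ∨ K_q) = A_b(G) + q`. -/
theorem ab_join_complete {α : Type*} [Fintype α] (G : SimpleGraph α)
    (q : ℕ) (hq : 1 ≤ q) :
    Ab (join G (completeGraph (Fin q))) = Ab G + q := by
  apply le_antisymm
  · obtain ⟨c, hc, hk⟩ := exists_isMinimal_ncolors_eq_Ab (join G (completeGraph (Fin q)))
    obtain ⟨hmin, hinj, hdisj⟩ := isMinimal_join_completeGraph_iff.1 hc
    rw [← hk, ncolors_sum hinj hdisj, Fintype.card_fin]
    exact Nat.add_le_add_right hmin.ncolors_le_Ab q
  · obtain ⟨c, hc, hk⟩ := exists_isMinimal_ncolors_eq_Ab G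
    let e : α ⊕ Fin q → ℕ := Sum.elim c fun b => Finset.univ.sup c + 1 + b
    have hinj : Function.Injective (e ∘ Sum.inr) := fun a b hab =>
      Fin.val_injective (Nat.add_left_cancel hab)
    have hdisj : ∀ a b, e (Sum.inl a) ≠ e (Sum.inr b) := by
      intro a b
      have : c a ≤ Finset.univ.sup c := Finset.le_sup (Finset.mem_univ a)
      simp only [e, Sum.elim_inl, Sum.elim_inr]
      omega
    have hn := ncolors_sum hinj hdisj
    rw [Fintype.card_fin] at hn
    rw [← hk]
    exact hn.symm.trans_le (isMinimal_join_completeGraph_iff.2 ⟨hc, hinj, hdisj⟩).ncolors_le_Ab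

end AcyclicB
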